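/- Let υ be a positive integer, k ∈ ℕ, and let p, q be reals with q > −1 and p + q < 1. Let a > 0 and w be reals with w^υ ≠ a^υ, and let y be real. Then the Laplace transform ∫_0^∞ e^{−a z} z^{−p−q} · _K M_{k;υ}^{(p,q)}(y, w z) dz converges and equals (q+1)_k · a^{p+q−1} · ((w^υ − a^υ)/a^υ)^k · Σ_{l=0}^{k} [(−k)_l (k+1−p)_l / ((q+1)_l l!)] · (y a^υ/(w^υ − a^υ))^l. -/

import Mathlib

open Finset MeasureTheory

/-- Pochhammer symbol `(a)_n = a (a+1) ⋯ (a+n-1)` for real `a`. -/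
noncomputable def poch (a : ℝ) (n : ℕ) : ℝ := (ascPochhammer ℝ n).eval a

/-- The finite bivariate M-Konhauser polynomial `_K M_{k;υ}^{(p,q)}(y,z)`. -/
noncomputable def MK (p q : ℝ) (υ k : ℕ) (y z : ℝ) : ℝ :=
  (-1 : ℝ) ^ k * Real.Gamma ((k : ℝ) + q + 1) *
    ∑ l ∈ range (k + 1), ∑ s ∈ range (k - l + 1),
      poch (-(k : ℝ)) (l + s) * poch ((k : ℝ) + 1 - p) l * (-y) ^ l * z ^ (υ * s) /
        (Real.Gamma ((l : ℝ) + q + 1) * Real.Gamma ((υ : ℝ) * (s : ℝ) - p - q + 1) *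
          (l.factorial : ℝ) * (s.factorial : ℝ))

theorem poch_add (a : ℝ) (m n : ℕ) : poch a (m + n) = poch a m * poch (a + m) n := by
  simp [poch, ← ascPochhammer_mul]

theorem poch_neg_natCast (n s : ℕ) :
    poch (-(n : ℝ)) s = (-1) ^ s * (n.choose s : ℝ) * (s.factorial : ℝ) := by
  rw [poch, ascPochhammer_eval_neg_eq_descPochhammer, descPochhammer_eval_eq_descFactorial,
    Nat.descFactorial_eq_factorial_mul_choose]
  push_cast
  ring

theorem poch_pos {a : ℝ} (ha : 0 < a) (n : ℕ) : 0 < poch a n :=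
  ascPochhammer_pos n a ha

/-- The Gamma function at a positive shifted argument, in terms of the Pochhammer symbol. -/
theorem Gamma_natCast_add {a : ℝ} (ha : 0 < a) (n : ℕ) :
    Real.Gamma (n + a) = poch a n * Real.Gamma a := by
  induction n with
  | zero => simp [poch]
  | succ n ih =>
    have h : (n : ℝ) + a ≠ 0 := by positivity
    rw [poch_add a n 1, show ((n + 1 : ℕ) : ℝ) + a = (n + a) + 1 by push_cast; ring,
      Real.Gamma_add_one h, ih]
    simp [poch]
    ring

/-- The terminating binomial series `₁F₀[-n; X] = (1 - X) ^ n`. -/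
theorem sum_poch_neg_natCast_mul_pow (n : ℕ) (X : ℝ) :
    ∑ s ∈ range (n + 1), poch (-(n : ℝ)) s * X ^ s / (s.factorial : ℝ) = (1 - X) ^ n := by
  rw [show 1 - X = -X + 1 by ring, add_pow]
  refine sum_congr rfl fun s _ => ?_
  have := Nat.cast_ne_zero (R := ℝ).2 s.factorial_ne_zero
  rw [poch_neg_natCast, neg_pow X s]
  field_simp
  simp

theorem sum_poch_neg_natCast_add_mul_pow {k l : ℕ} (h : l ≤ k) (X : ℝ) :
    ∑ s ∈ range (k - l + 1), poch (-(k : ℝ)) (l + s) * X ^ s / (s.factorial : ℝ) =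
      poch (-(k : ℝ)) l * (1 - X) ^ (k - l) := by
  rw [← sum_poch_neg_natCast_mul_pow, mul_sum]
  refine sum_congr rfl fun s _ => ?_
  rw [poch_add, Nat.cast_sub h, show -(k : ℝ) + l = -((k : ℝ) - l) by ring]
  ring

theorem integrableOn_rpow_mul_exp_neg_mul_Ioi {r a : ℝ} (hr : 0 < r) (ha : 0 < a) :
    IntegrableOn (fun z : ℝ => z ^ (r - 1) * Real.exp (-(a * z))) (Set.Ioi 0) := by
  refine not_imp_comm.1 integral_undef ?_
  rw [Real.integral_rpow_mul_exp_neg_mul_Ioi hr ha]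
  have := Real.Gamma_pos_of_pos hr
  positivity

theorem one_div_rpow_natCast_sub_add_one {a : ℝ} (ha : 0 < a) (c : ℝ) (m : ℕ) :
    (1 / a) ^ ((m : ℝ) - c + 1) = a ^ (c - 1) / a ^ m := by
  rw [one_div, Real.inv_rpow ha.le, ← Real.rpow_neg ha.le, ← Real.rpow_natCast a m,
    ← Real.rpow_sub ha]
  congr 1
  ring

/-- Laplace transform of the finite bivariate M-Konhauser polynomials in the second
variable, expressed as a terminating `₂F₁` series. -/
theorem MK_laplace_2F1 (υ : ℕ) (hυ : 0 < υ) (k : ℕ) (p q : ℝ) (hq : q > -1)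
    (hpq : p + q < 1) (a w : ℝ) (ha : 0 < a) (hw : w ^ υ ≠ a ^ υ) (y : ℝ) :
    IntegrableOn (fun z => Real.exp (-(a * z)) * z ^ (-p - q) * MK p q υ k y (w * z))
      (Set.Ioi (0 : ℝ)) ∧
    (∫ z in Set.Ioi (0 : ℝ), Real.exp (-(a * z)) * z ^ (-p - q) * MK p q υ k y (w * z))
      = poch (q + 1) k * a ^ (p + q - 1) * ((w ^ υ - a ^ υ) / a ^ υ) ^ k *
        ∑ l ∈ range (k + 1),
          poch (-(k : ℝ)) l * poch ((k : ℝ) + 1 - p) l / (poch (q + 1) l * (l.factorial : ℝ)) *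
            (y * a ^ υ / (w ^ υ - a ^ υ)) ^ l := by
  set r : ℕ → ℝ := fun s => ((υ * s : ℕ) : ℝ) - (p + q) + 1 with hr
  have r_pos (s : ℕ) : 0 < r s := by
    have : (0 : ℝ) ≤ ((υ * s : ℕ) : ℝ) := Nat.cast_nonneg _
    simp only [hr]
    linarith
  set C : ℕ → ℕ → ℝ := fun l s => (-1 : ℝ) ^ k * Real.Gamma ((k : ℝ) + q + 1) *
    (poch (-(k : ℝ)) (l + s) * poch ((k : ℝ) + 1 - p) l * (-y) ^ l * w ^ (υ * s) /
        (Real.Gamma ((l : ℝ) + q + 1) * Real.Gamma (r s) *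
          (l.factorial : ℝ) * (s.factorial : ℝ))) with hC
  have expand : Set.EqOn (fun z => Real.exp (-(a * z)) * z ^ (-p - q) * MK p q υ k y (w * z))
      (fun z => ∑ l ∈ range (k + 1), ∑ s ∈ range (k - l + 1),
        C l s * (z ^ (r s - 1) * Real.exp (-(a * z)))) (Set.Ioi 0) := by
    intro z hz
    simp only [MK, mul_sum]
    refine sum_congr rfl fun l _ => sum_congr rfl fun s _ => ?_
    have hzr : z ^ (r s - 1) = z ^ (-p - q) * z ^ (υ * s) := by
      rw [← Real.rpow_natCast z, ← Real.rpow_add hz]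
      congr 1
      simp only [hr]
      ring
    have hrs : (υ : ℝ) * (s : ℝ) - p - q + 1 = r s := by
      simp only [hr]
      push_cast
      ring
    simp only [hC, hzr, hrs, mul_pow]
    ring
  have term_int (l s : ℕ) : IntegrableOn
      (fun z : ℝ => C l s * (z ^ (r s - 1) * Real.exp (-(a * z)))) (Set.Ioi 0) :=
    (integrableOn_rpow_mul_exp_neg_mul_Ioi (r_pos s) ha).const_mul _
  have row_int (l : ℕ) : IntegrableOn (fun z : ℝ => ∑ s ∈ range (k - l + 1),
      C l s * (z ^ (r s - 1) * Real.exp (-(a * z)))) (Set.Ioi 0) :=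
    integrable_finsetSum _ fun s _ => term_int l s
  refine ⟨(integrableOn_congr_fun expand measurableSet_Ioi).2
    (integrable_finsetSum _ fun l _ => row_int l), ?_⟩
  rw [setIntegral_congr_fun measurableSet_Ioi expand, integral_finsetSum _ fun l _ => row_int l,
    mul_sum]
  refine sum_congr rfl fun l hl => ?_
  have hlk : l ≤ k := Nat.lt_succ_iff.1 (mem_range.1 hl)
  have hq1 : 0 < q + 1 := by linarith
  have hG := (Real.Gamma_pos_of_pos hq1).ne'
  have hP := (poch_pos hq1 l).ne'
  have hl0 := Nat.cast_ne_zero (R := ℝ).2 l.factorial_ne_zero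
  have hau : a ^ υ ≠ 0 := by positivity
  have hd : w ^ υ - a ^ υ ≠ 0 := sub_ne_zero.2 hw
  have row : ∀ s ∈ range (k - l + 1),
      ∫ z in Set.Ioi (0 : ℝ), C l s * (z ^ (r s - 1) * Real.exp (-(a * z))) =
        (-1) ^ k * poch (q + 1) k * a ^ (p + q - 1) * poch ((k : ℝ) + 1 - p) l * (-y) ^ l /
          (poch (q + 1) l * (l.factorial : ℝ)) *
          (poch (-(k : ℝ)) (l + s) * (w ^ υ / a ^ υ) ^ s / (s.factorial : ℝ)) := by
    intro s _
    have hs0 := Nat.cast_ne_zero (R := ℝ).2 s.factorial_ne_zero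
    have hGr := (Real.Gamma_pos_of_pos (r_pos s)).ne'
    rw [integral_const_mul, Real.integral_rpow_mul_exp_neg_mul_Ioi (r_pos s) ha,
      one_div_rpow_natCast_sub_add_one ha (p + q)]
    simp only [hC, add_assoc, Gamma_natCast_add hq1, pow_mul, div_pow]
    field_simp
  rw [integral_finsetSum _ fun s _ => term_int l s, sum_congr rfl row, ← mul_sum,
    sum_poch_neg_natCast_add_mul_pow hlk]
  obtain ⟨m, rfl⟩ := Nat.exists_eq_add_of_le hlk
  rw [Nat.add_sub_cancel_left,
    show 1 - w ^ υ / a ^ υ = -((w ^ υ - a ^ υ) / a ^ υ) by field_simp; ring,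
    neg_pow _ m, neg_pow y l]
  have hsign : ((-1 : ℝ)) ^ (l + m) * (-1) ^ l * (-1) ^ m = 1 := by
    rw [mul_assoc, ← pow_add, ← mul_pow]
    simp
  have hpow : ((w ^ υ - a ^ υ) / a ^ υ) ^ (l + m) * (y * a ^ υ / (w ^ υ - a ^ υ)) ^ l =
      y ^ l * ((w ^ υ - a ^ υ) / a ^ υ) ^ m := by
    rw [pow_add, mul_right_comm, ← mul_pow]
    congr 2
    field_simp
  linear_combination
    (poch (q + 1) (l + m) * a ^ (p + q - 1) * poch (((l + m : ℕ) : ℝ) + 1 - p) l * y ^ l /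
      (poch (q + 1) l * (l.factorial : ℝ)) * poch (-((l + m : ℕ) : ℝ)) l *
      ((w ^ υ - a ^ υ) / a ^ υ) ^ m) * hsign -
    (poch (q + 1) (l + m) * a ^ (p + q - 1) * poch (((l + m : ℕ) : ℝ) + 1 - p) l /
      (poch (q + 1) l * (l.factorial : ℝ)) * poch (-((l + m : ℕ) : ℝ)) l) * hpow
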